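/- Let α be a non-degenerate 3-form on ℝ⁶. Then λ_α < 0 if and only if there exists a linear isomorphism g : ℝ⁶ → ℝ⁶ with g*α = α_(ii). -/

import Mathlib

/-- `dx3 i j k` is the alternating 3-form `dxⁱ ∧ dxʲ ∧ dxᵏ` on `ℝ⁶ = Fin 6 → ℝ`. -/
noncomputable def dx3 (i j k : Fin 6) : AlternatingMap ℝ (Fin 6 → ℝ) ℝ (Fin 3) :=
  (Matrix.detRowAlternating : AlternatingMap ℝ (Fin 3 → ℝ) ℝ (Fin 3)).compLinearMap
    (LinearMap.funLeft ℝ ℝ ![i, j, k])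

/-- The volume form `dx¹ ∧ dx² ∧ dx³ ∧ dx⁴ ∧ dx⁵ ∧ dx⁶` on `ℝ⁶`. -/
noncomputable def dvol : AlternatingMap ℝ (Fin 6 → ℝ) ℝ (Fin 6) :=
  Matrix.detRowAlternating

/-- The wedge product of alternating forms on `ℝ⁶` (shuffle convention). -/
noncomputable def wedge {m n : ℕ} (a : AlternatingMap ℝ (Fin 6 → ℝ) ℝ (Fin m))
    (b : AlternatingMap ℝ (Fin 6 → ℝ) ℝ (Fin n)) :
    AlternatingMap ℝ (Fin 6 → ℝ) ℝ (Fin (m + n)) :=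
  (((TensorProduct.lid ℝ ℝ).toLinearMap.compAlternatingMap
    (AlternatingMap.domCoprod a b)).domDomCongr finSumFinEquiv)

/-- `α_(i) = dx^{123} + dx^{456}`. -/
noncomputable def alphaI : AlternatingMap ℝ (Fin 6 → ℝ) ℝ (Fin 3) :=
  dx3 0 1 2 + dx3 3 4 5

/-- `α_(ii) = dx^{135} − dx^{146} − dx^{236} − dx^{245}`. -/
noncomputable def alphaII : AlternatingMap ℝ (Fin 6 → ℝ) ℝ (Fin 3) :=
  dx3 0 2 4 - dx3 0 3 5 - dx3 1 2 5 - dx3 1 3 4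

/-- `α_(iii) = dx^{156} − dx^{246} + dx^{345}`. -/
noncomputable def alphaIII : AlternatingMap ℝ (Fin 6 → ℝ) ℝ (Fin 3) :=
  dx3 0 4 5 - dx3 1 3 5 + dx3 2 3 4

section

open Equiv
open scoped TensorProduct

/-- Representatives of the `(2, 3)`-shuffles. -/
def shuffle23 : Fin 10 → Perm (Fin 2 ⊕ Fin 3) :=
  ![1, swap (.inl 1) (.inr 0), swap (.inl 1) (.inr 1), swap (.inl 1) (.inr 2),
    swap (.inl 0) (.inr 0), swap (.inl 0) (.inr 1), swap (.inl 0) (.inr 2),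
    swap (.inl 0) (.inr 0) * swap (.inl 1) (.inr 1),
    swap (.inl 0) (.inr 0) * swap (.inl 1) (.inr 2),
    swap (.inl 0) (.inr 1) * swap (.inl 1) (.inr 2)]

theorem shuffle23_injective : Function.Injective
    (fun i => (Quotient.mk'' (shuffle23 i) : Perm.ModSumCongr (Fin 2) (Fin 3))) := by
  intro i j h
  obtain ⟨x, hx⟩ := QuotientGroup.leftRel_apply.mp (Quotient.exact' h)
  have key : ∀ k, (((shuffle23 i)⁻¹ * shuffle23 j) (.inl k)).isLeft = true := fun k => by
    rw [← hx]; simp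
  clear h hx
  revert i j
  decide +kernel

theorem shuffle23_bijective : Function.Bijective
    (fun i => (Quotient.mk'' (shuffle23 i) : Perm.ModSumCongr (Fin 2) (Fin 3))) := by
  refine (Nat.bijective_iff_injective_and_card _).2 ⟨shuffle23_injective, ?_⟩
  have h : _ = Nat.card (Perm.ModSumCongr (Fin 2) (Fin 3)) * _ :=
    Subgroup.card_eq_card_quotient_mul_card_subgroup _
  rw [← Nat.card_congr (MonoidHom.ofInjective Perm.sumCongrHom_injective).toEquiv,
    Nat.card_prod, Nat.card_perm, Nat.card_perm, Nat.card_perm] at h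
  simp only [Nat.card_sum, Nat.card_fin, Nat.factorial] at h ⊢
  exact Nat.eq_of_mul_eq_mul_right (by norm_num : 0 < 12) h

theorem wedge_two_three_apply (a : AlternatingMap ℝ (Fin 6 → ℝ) ℝ (Fin 2))
    (b : AlternatingMap ℝ (Fin 6 → ℝ) ℝ (Fin 3)) (m : Fin 5 → Fin 6 → ℝ) :
    wedge a b m =
      a ![m 0, m 1] * b ![m 2, m 3, m 4] - a ![m 0, m 2] * b ![m 1, m 3, m 4]
      - a ![m 0, m 3] * b ![m 2, m 1, m 4] - a ![m 0, m 4] * b ![m 2, m 3, m 1]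
      - a ![m 2, m 1] * b ![m 0, m 3, m 4] - a ![m 3, m 1] * b ![m 2, m 0, m 4]
      - a ![m 4, m 1] * b ![m 2, m 3, m 0] + a ![m 2, m 3] * b ![m 0, m 1, m 4]
      + a ![m 2, m 4] * b ![m 0, m 3, m 1] + a ![m 3, m 4] * b ![m 2, m 0, m 1] := by
  have h (i : Fin 10) :
      TensorProduct.lid ℝ ℝ (AlternatingMap.domCoprod.summand a b (Quotient.mk'' (shuffle23 i))
        (m ∘ finSumFinEquiv)) = Perm.sign (shuffle23 i) •
      (a ![m (finSumFinEquiv (shuffle23 i (.inl 0))), m (finSumFinEquiv (shuffle23 i (.inl 1)))] *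
        b ![m (finSumFinEquiv (shuffle23 i (.inr 0))), m (finSumFinEquiv (shuffle23 i (.inr 1))),
          m (finSumFinEquiv (shuffle23 i (.inr 2)))]) := by
    have hl : ![m (finSumFinEquiv (shuffle23 i (.inl 0))),
        m (finSumFinEquiv (shuffle23 i (.inl 1)))] =
        fun k => m (finSumFinEquiv (shuffle23 i (.inl k))) := by
      ext k; fin_cases k <;> rfl
    have hr : ![m (finSumFinEquiv (shuffle23 i (.inr 0))),
        m (finSumFinEquiv (shuffle23 i (.inr 1))), m (finSumFinEquiv (shuffle23 i (.inr 2)))] =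
        fun k => m (finSumFinEquiv (shuffle23 i (.inr k))) := by
      ext k; fin_cases k <;> rfl
    rw [AlternatingMap.domCoprod.summand_mk'', hl, hr]
    change TensorProduct.lid ℝ ℝ (Perm.sign (shuffle23 i) • (_ ⊗ₜ[ℝ] _)) = _
    rw [Units.smul_def, map_zsmul, TensorProduct.lid_tmul, Units.smul_def]
    rfl
  have e : wedge a b m = ∑ i, TensorProduct.lid ℝ ℝ
      (AlternatingMap.domCoprod.summand a b (Quotient.mk'' (shuffle23 i))
        (m ∘ finSumFinEquiv)) := by
    unfold wedge
    rw [AlternatingMap.domDomCongr_apply, LinearMap.compAlternatingMap_apply,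
      AlternatingMap.domCoprod_apply, _root_.sum_apply, map_sum]
    exact (shuffle23_bijective.sum_comp (fun q => TensorProduct.lid ℝ ℝ (AlternatingMap.domCoprod.summand a b q
      (m ∘ finSumFinEquiv)))).symm
  have f : finSumFinEquiv (.inl 0 : Fin 2 ⊕ Fin 3) = 0 ∧
      finSumFinEquiv (.inl 1 : Fin 2 ⊕ Fin 3) = 1 ∧ finSumFinEquiv (.inr 0 : Fin 2 ⊕ Fin 3) = 2 ∧
      finSumFinEquiv (.inr 1 : Fin 2 ⊕ Fin 3) = 3 ∧
      finSumFinEquiv (.inr 2 : Fin 2 ⊕ Fin 3) = 4 := ⟨rfl, rfl, rfl, rfl, rfl⟩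
  rw [e]
  simp only [h, Fin.sum_univ_succ]
  simp [shuffle23, swap_apply_def, f]
  ring

end

/-- The linear map `J` is the endomorphism `J_α` associated with the 3-form `α`. -/
def IsHitchin (α : AlternatingMap ℝ (Fin 6 → ℝ) ℝ (Fin 3))
    (J : (Fin 6 → ℝ) →ₗ[ℝ] (Fin 6 → ℝ)) : Prop :=
  ∀ v : Fin 6 → ℝ, wedge (α.curryLeft v) α = dvol.curryLeft (J v)

set_option maxRecDepth 4000 in
theorem wedge_compLinearMap (a : AlternatingMap ℝ (Fin 6 → ℝ) ℝ (Fin 2))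
    (b : AlternatingMap ℝ (Fin 6 → ℝ) ℝ (Fin 3)) (g : (Fin 6 → ℝ) →ₗ[ℝ] (Fin 6 → ℝ)) :
    wedge (a.compLinearMap g) (b.compLinearMap g) = (wedge a b).compLinearMap g := by
  have h2 (x y : Fin 6 → ℝ) : (fun i => g (![x, y] i)) = ![g x, g y] := by
    ext i; fin_cases i <;> rfl
  have h3 (x y z : Fin 6 → ℝ) : (fun i => g (![x, y, z] i)) = ![g x, g y, g z] := by
    ext i; fin_cases i <;> rfl
  have h (m : Fin 5 → Fin 6 → ℝ) : wedge (a.compLinearMap g) (b.compLinearMap g) m =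
      wedge a b fun i : Fin 5 => g (m i) := by
    simp only [wedge_two_three_apply, AlternatingMap.compLinearMap_apply, h2, h3]
  ext m
  exact h m

theorem dvol_eq_basis_det : dvol = (Pi.basisFun ℝ (Fin 6)).det := by
  rw [Pi.basisFun_det]
  unfold dvol
  rfl

theorem dvol_compLinearMap (g : (Fin 6 → ℝ) →ₗ[ℝ] (Fin 6 → ℝ)) :
    dvol.compLinearMap g = LinearMap.det g • dvol := by
  rw [dvol_eq_basis_det]
  ext m
  rw [AlternatingMap.compLinearMap_apply, AlternatingMap.smul_apply, smul_eq_mul]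
  exact (Pi.basisFun ℝ (Fin 6)).det_comp g m

theorem IsHitchin.compLinearMap {α : AlternatingMap ℝ (Fin 6 → ℝ) ℝ (Fin 3)}
    {J : (Fin 6 → ℝ) →ₗ[ℝ] (Fin 6 → ℝ)} (hJ : IsHitchin α J)
    (g : (Fin 6 → ℝ) ≃ₗ[ℝ] (Fin 6 → ℝ)) :
    IsHitchin (α.compLinearMap (g : (Fin 6 → ℝ) →ₗ[ℝ] (Fin 6 → ℝ)))
      (LinearMap.det (g : (Fin 6 → ℝ) →ₗ[ℝ] (Fin 6 → ℝ)) • g.symm.conj J) := by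
  intro v
  rw [AlternatingMap.curryLeft_compLinearMap, wedge_compLinearMap]
  erw [hJ]
  have h : J (g v) = g (g.symm.conj J v) := by simp [LinearEquiv.conj_apply]
  rw [LinearEquiv.coe_coe, h]
  erw [← AlternatingMap.curryLeft_compLinearMap, dvol_compLinearMap]
  ext m
  simp

set_option maxRecDepth 10000 in
theorem dvol_apply (m : Fin 6 → Fin 6 → ℝ) : dvol m = Matrix.det (Matrix.of m) := rfl

/-- The coordinates of a vector are read off from the volume form. -/
theorem dvol_curryLeft_succAbove (v : Fin 6 → ℝ) (j : Fin 6) :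
    dvol.curryLeft v (fun k => Pi.single (j.succAbove k) 1) = (-1) ^ (j : ℕ) * v j := by
  rw [AlternatingMap.curryLeft_apply_apply, dvol_apply, Matrix.det_succ_row_zero, Finset.sum_eq_single j]
  · have : (Matrix.of (Matrix.vecCons v fun k => Pi.single (j.succAbove k) (1 : ℝ))).submatrix
        Fin.succ j.succAbove = 1 := by
      ext r c
      simp [Matrix.one_apply, Pi.single_apply, eq_comm]
    rw [this]
    simp
  · intro k _ hk
    obtain ⟨r, rfl⟩ := Fin.exists_succAbove_eq hk
    rw [Matrix.det_eq_zero_of_row_eq_zero r, mul_zero]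
    intro c
    simp [Pi.single_apply]
  · simp

theorem IsHitchin.apply_eq {α : AlternatingMap ℝ (Fin 6 → ℝ) ℝ (Fin 3)}
    {J : (Fin 6 → ℝ) →ₗ[ℝ] (Fin 6 → ℝ)} (hJ : IsHitchin α J) (v : Fin 6 → ℝ) (j : Fin 6) :
    J v j = (-1) ^ (j : ℕ) *
      wedge (α.curryLeft v) α (fun k : Fin 5 => Pi.single (j.succAbove k) 1) := by
  have h := dvol_curryLeft_succAbove (J v) j
  rw [← hJ v] at h
  rw [h, ← mul_assoc, ← pow_add, ← two_mul]
  simp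

theorem AlternatingMap.map_swap_zero_one {R M N : Type*} [CommRing R] [AddCommGroup M]
    [AddCommGroup N] [Module R M] [Module R N] (f : AlternatingMap R M N (Fin 3)) (x y z : M) :
    f ![x, y, z] = -f ![y, x, z] := by
  rw [← f.map_swap ![y, x, z] (i := 0) (j := 1) (by decide)]
  congr 1
  ext i
  fin_cases i <;> rfl

theorem AlternatingMap.map_swap_one_two {R M N : Type*} [CommRing R] [AddCommGroup M]
    [AddCommGroup N] [Module R M] [Module R N] (f : AlternatingMap R M N (Fin 3)) (x y z : M) :
    f ![x, y, z] = -f ![x, z, y] := by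
  rw [← f.map_swap ![x, z, y] (i := 1) (j := 2) (by decide)]
  congr 1
  ext i
  fin_cases i <;> rfl

theorem AlternatingMap.map_zero_one_self {R M N : Type*} [CommRing R] [AddCommGroup M]
    [AddCommGroup N] [Module R M] [Module R N] (f : AlternatingMap R M N (Fin 3)) (x y : M) :
    f ![x, x, y] = 0 :=
  f.map_eq_zero_of_eq _ (i := 0) (j := 1) rfl (by decide)

theorem AlternatingMap.map_one_two_self {R M N : Type*} [CommRing R] [AddCommGroup M]
    [AddCommGroup N] [Module R M] [Module R N] (f : AlternatingMap R M N (Fin 3)) (x y : M) :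
    f ![x, y, y] = 0 :=
  f.map_eq_zero_of_eq _ (i := 1) (j := 2) rfl (by decide)

theorem LinearMap.apply_eq_sum_single {ι R M : Type*} [Fintype ι] [DecidableEq ι] [CommSemiring R]
    [AddCommMonoid M] [Module R M] (f : (ι → R) →ₗ[R] M) (x : ι → R) :
    f x = ∑ k, x k • f (Pi.single k 1) := by
  conv_lhs => rw [pi_eq_sum_univ' x]
  simp

/-- The components of a 3-form in the standard basis. -/
noncomputable def component (α : AlternatingMap ℝ (Fin 6 → ℝ) ℝ (Fin 3)) (i j k : Fin 6) : ℝ :=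
  α ![Pi.single i 1, Pi.single j 1, Pi.single k 1]

theorem component_of_lt_left (α : AlternatingMap ℝ (Fin 6 → ℝ) ℝ (Fin 3)) {i j : Fin 6}
    (k : Fin 6) (_ : j < i) : component α i j k = -component α j i k :=
  α.map_swap_zero_one _ _ _

theorem component_of_lt_right (α : AlternatingMap ℝ (Fin 6 → ℝ) ℝ (Fin 3)) (i : Fin 6)
    {j k : Fin 6} (_ : k < j) : component α i j k = -component α i k j :=
  α.map_swap_one_two _ _ _

theorem component_self_left (α : AlternatingMap ℝ (Fin 6 → ℝ) ℝ (Fin 3)) (i j : Fin 6) :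
    component α i i j = 0 :=
  α.map_zero_one_self _ _

theorem component_self_right (α : AlternatingMap ℝ (Fin 6 → ℝ) ℝ (Fin 3)) (i j : Fin 6) :
    component α i j j = 0 :=
  α.map_one_two_self _ _

theorem IsHitchin.apply_single_eq {α : AlternatingMap ℝ (Fin 6 → ℝ) ℝ (Fin 3)}
    {J : (Fin 6 → ℝ) →ₗ[ℝ] (Fin 6 → ℝ)} (hJ : IsHitchin α J) (i j : Fin 6) :
    J (Pi.single i 1) j = (-1) ^ (j : ℕ) *
      (let a := component α i
      let b := component α
      let s := j.succAbove
      a (s 0) (s 1) * b (s 2) (s 3) (s 4) - a (s 0) (s 2) * b (s 1) (s 3) (s 4)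
      - a (s 0) (s 3) * b (s 2) (s 1) (s 4) - a (s 0) (s 4) * b (s 2) (s 3) (s 1)
      - a (s 2) (s 1) * b (s 0) (s 3) (s 4) - a (s 3) (s 1) * b (s 2) (s 0) (s 4)
      - a (s 4) (s 1) * b (s 2) (s 3) (s 0) + a (s 2) (s 3) * b (s 0) (s 1) (s 4)
      + a (s 2) (s 4) * b (s 0) (s 3) (s 1) + a (s 3) (s 4) * b (s 2) (s 0) (s 1)) := by
  rw [hJ.apply_eq]
  exact congrArg _ (wedge_two_three_apply _ _ _)

theorem IsHitchin.component_apply_single {α : AlternatingMap ℝ (Fin 6 → ℝ) ℝ (Fin 3)}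
    {J : (Fin 6 → ℝ) →ₗ[ℝ] (Fin 6 → ℝ)} (hJ : IsHitchin α J) :
    α ![J (Pi.single 0 1), Pi.single 0 1, Pi.single 1 1] = 0 := by
  have h : α ![J (Pi.single 0 1), Pi.single 0 1, Pi.single 1 1] =
      ∑ k, J (Pi.single 0 1) k * component α k 0 1 := by
    have := congrArg (fun f => f ![Pi.single 0 1, Pi.single 1 1])
      (α.curryLeft.apply_eq_sum_single (J (Pi.single 0 1)))
    simpa [component] using! this
  rw [h]
  simp [Fin.sum_univ_succ, hJ.apply_single_eq, Fin.succAbove, component_of_lt_left,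
    component_of_lt_right, component_self_left, component_self_right]
  ring

theorem IsHitchin.sq_apply_single {α : AlternatingMap ℝ (Fin 6 → ℝ) ℝ (Fin 3)}
    {J : (Fin 6 → ℝ) →ₗ[ℝ] (Fin 6 → ℝ)} (hJ : IsHitchin α J) :
    J (J (Pi.single 0 1)) 1 = 0 := by
  have h : J (J (Pi.single 0 1)) 1 = ∑ k, J (Pi.single 0 1) k * J (Pi.single k 1) 1 := by
    have := congrFun (J.apply_eq_sum_single (J (Pi.single 0 1))) 1
    simpa using! this
  rw [h]
  simp [Fin.sum_univ_succ, hJ.apply_single_eq, Fin.succAbove, component_of_lt_left,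
    component_of_lt_right, component_self_left, component_self_right]
  ring
/-- Two linearly independent vectors are the images of the first two basis vectors under a linear
automorphism. -/
theorem exists_linearEquiv_apply_single {u w : Fin 6 → ℝ} (h : LinearIndependent ℝ ![u, w]) :
    ∃ g : (Fin 6 → ℝ) ≃ₗ[ℝ] (Fin 6 → ℝ), g (Pi.single 0 1) = u ∧ g (Pi.single 1 1) = w := by
  let b : Module.Basis (Fin 2 ⊕ Module.Basis.sumExtendIndex h) ℝ (Fin 6 → ℝ) :=
    Module.Basis.sumExtend h
  have : Finite (Fin 2 ⊕ Module.Basis.sumExtendIndex h) := Module.Finite.finite_basis b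
  have : Finite (Module.Basis.sumExtendIndex h) :=
    Finite.of_injective (Sum.inr (α := Fin 2)) Sum.inr_injective
  have hc := Module.finrank_eq_nat_card_basis b
  rw [Module.finrank_fin_fun, Nat.card_sum, Nat.card_fin] at hc
  let e : Fin 2 ⊕ Module.Basis.sumExtendIndex h ≃ Fin 6 :=
    (Equiv.sumCongr (Equiv.refl _) (Finite.equivFinOfCardEq (n := 4) (by omega))).trans
      finSumFinEquiv
  have h0 : e.symm 0 = .inl 0 := e.symm_apply_eq.2 rfl
  have h1 : e.symm 1 = .inl 1 := e.symm_apply_eq.2 rfl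
  have hb (i : Fin 2) : b (.inl i) = ![u, w] i := by
    simp only [b, Module.Basis.sumExtend, Module.Basis.reindex_apply,
      Module.Basis.extend_apply_self]
    rfl
  refine ⟨(Pi.basisFun ℝ (Fin 6)).equiv (b.reindex e) (Equiv.refl _), ?_, ?_⟩
  · have := (Pi.basisFun ℝ (Fin 6)).equiv_apply 0 (b.reindex e) (Equiv.refl _)
    simpa [h0, hb] using this
  · have := (Pi.basisFun ℝ (Fin 6)).equiv_apply 1 (b.reindex e) (Equiv.refl _)
    simpa [h1, hb] using this

theorem IsHitchin.apply_self {α : AlternatingMap ℝ (Fin 6 → ℝ) ℝ (Fin 3)}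
    {J : (Fin 6 → ℝ) →ₗ[ℝ] (Fin 6 → ℝ)} (hJ : IsHitchin α J) (u w : Fin 6 → ℝ) :
    α ![J u, u, w] = 0 := by
  by_cases h : LinearIndependent ℝ ![u, w]
  · obtain ⟨g, rfl, rfl⟩ := exists_linearEquiv_apply_single h
    have := (hJ.compLinearMap g).component_apply_single
    have h3 (x y z : Fin 6 → ℝ) : (fun i => g (![x, y, z] i)) = ![g x, g y, g z] := by
      ext i; fin_cases i <;> rfl
    have hs (c : ℝ) (x y z : Fin 6 → ℝ) : α ![c • x, y, z] = c * α ![x, y, z] :=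
      α.map_vecCons_smul ![y, z] c x
    simpa [h3, hs, LinearEquiv.conj_apply, (LinearEquiv.isUnit_det' g).ne_zero] using this
  · refine α.map_linearDependent _ fun hi => h ?_
    have hc := hi.comp ![1, 2] (by decide)
    rwa [show ![J u, u, w] ∘ ![1, 2] = ![u, w] by ext i; fin_cases i <;> rfl] at hc

theorem IsHitchin.apply_comm {α : AlternatingMap ℝ (Fin 6 → ℝ) ℝ (Fin 3)}
    {J : (Fin 6 → ℝ) →ₗ[ℝ] (Fin 6 → ℝ)} (hJ : IsHitchin α J) (u v w : Fin 6 → ℝ) :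
    α ![u, J v, w] = α ![J u, v, w] := by
  have ha (x y z t : Fin 6 → ℝ) : α ![x + y, z, t] = α ![x, z, t] + α ![y, z, t] :=
    α.map_vecCons_add ![z, t] x y
  have hb (x y z t : Fin 6 → ℝ) : α ![t, x + y, z] = α ![t, x, z] + α ![t, y, z] :=
    (α.curryLeft t).map_vecCons_add ![z] x y
  have h := hJ.apply_self (u + v) w
  rw [map_add, ha, hb, hb, hJ.apply_self, hJ.apply_self, α.map_swap_zero_one (J v)] at h
  linarith

theorem IsHitchin.exists_sq_eq_smul {α : AlternatingMap ℝ (Fin 6 → ℝ) ℝ (Fin 3)}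
    {J : (Fin 6 → ℝ) →ₗ[ℝ] (Fin 6 → ℝ)} (hJ : IsHitchin α J) :
    ∃ c : ℝ, J ∘ₗ J = c • LinearMap.id := by
  apply LinearMap.exists_eq_smul_id_of_forall_notLinearIndependent
  intro v h
  obtain ⟨g, hv, hw⟩ := exists_linearEquiv_apply_single h
  have := (hJ.compLinearMap g).sq_apply_single
  have hw' : g.symm (J (J v)) = Pi.single 1 1 := g.symm_apply_eq.2 hw.symm
  simp [LinearEquiv.conj_apply, hv, hw', (LinearEquiv.isUnit_det' g).ne_zero] at this

/-- Alternating maps are determined by their values on increasing families of basis vectors. -/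
theorem Module.Basis.ext_alternating_of_strictMono {R M N ι : Type*} {n : ℕ} [CommRing R]
    [AddCommGroup M] [AddCommGroup N] [Module R M] [Module R N] [LinearOrder ι]
    {f g : AlternatingMap R M N (Fin n)} (e : Module.Basis ι R M)
    (h : ∀ v : Fin n → ι, StrictMono v → (f fun i => e (v i)) = g fun i => e (v i)) : f = g := by
  refine e.ext_alternating fun v hv => ?_
  have hs := h (v ∘ Tuple.sort v)
    ((Tuple.monotone_sort v).strictMono_of_injective (hv.comp (Tuple.sort v).injective))
  have hf := f.map_perm (fun i => e (v i)) (Tuple.sort v)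
  have hg := g.map_perm (fun i => e (v i)) (Tuple.sort v)
  exact smul_left_cancel (Equiv.Perm.sign (Tuple.sort v)) (hf.symm.trans (hs.trans hg))
theorem dx3_apply (i j k : Fin 6) (x y z : Fin 6 → ℝ) :
    dx3 i j k ![x, y, z] = x i * (y j * z k - y k * z j) - x j * (y i * z k - y k * z i) +
      x k * (y i * z j - y j * z i) := by
  have h : dx3 i j k ![x, y, z] =
      Matrix.det (Matrix.of fun r => LinearMap.funLeft ℝ ℝ ![i, j, k] (![x, y, z] r)) := rfl
  rw [h, Matrix.det_fin_three]
  simp [LinearMap.funLeft_apply]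
  ring

theorem alphaII_apply (x y z : Fin 6 → ℝ) :
    alphaII ![x, y, z] = dx3 0 2 4 ![x, y, z] - dx3 0 3 5 ![x, y, z] - dx3 1 2 5 ![x, y, z] -
      dx3 1 3 4 ![x, y, z] :=
  rfl

theorem IsHitchin.sq_apply_single_of_alphaII {J : (Fin 6 → ℝ) →ₗ[ℝ] (Fin 6 → ℝ)}
    (hJ : IsHitchin alphaII J) : J (J (Pi.single 0 1)) 0 = -4 := by
  have h : J (J (Pi.single 0 1)) 0 = ∑ k, J (Pi.single 0 1) k * J (Pi.single k 1) 0 := by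
    have := congrFun (J.apply_eq_sum_single (J (Pi.single 0 1))) 0
    simpa using! this
  rw [h]
  simp [Fin.sum_univ_succ, hJ.apply_single_eq, Fin.succAbove, component, alphaII_apply, dx3_apply]
  norm_num

theorem IsHitchin.trace_sq_neg_of_alphaII {J : (Fin 6 → ℝ) →ₗ[ℝ] (Fin 6 → ℝ)}
    (hJ : IsHitchin alphaII J) : LinearMap.trace ℝ (Fin 6 → ℝ) (J ∘ₗ J) < 0 := by
  obtain ⟨c, hc⟩ := hJ.exists_sq_eq_smul
  have h := hJ.sq_apply_single_of_alphaII
  rw [← LinearMap.comp_apply, hc] at h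
  have h' : c = -4 := by simpa using h
  rw [hc, map_smul, LinearMap.trace_id, h']
  norm_num

/-- A linear map compatible with a 3-form can be moved to the first argument. -/
theorem map_last_of_map_middle {α : AlternatingMap ℝ (Fin 6 → ℝ) ℝ (Fin 3)}
    {I : (Fin 6 → ℝ) →ₗ[ℝ] (Fin 6 → ℝ)} (hc : ∀ u v w, α ![u, I v, w] = α ![I u, v, w])
    (u v w : Fin 6 → ℝ) : α ![u, v, I w] = α ![I u, v, w] := by
  rw [α.map_swap_one_two, hc, α.map_swap_one_two, neg_neg]

/-- A nonzero 3-form compatible with a complex structure takes the value `1` on some triple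
`(u, v, w)` while vanishing on `(I u, v, w)`. -/
theorem exists_apply_eq_one_of_complex {α : AlternatingMap ℝ (Fin 6 → ℝ) ℝ (Fin 3)} (h0 : α ≠ 0)
    {I : (Fin 6 → ℝ) →ₗ[ℝ] (Fin 6 → ℝ)} (hI : ∀ v, I (I v) = -v) :
    ∃ u v w, α ![u, v, w] = 1 ∧ α ![I u, v, w] = 0 := by
  have ha (x y z t : Fin 6 → ℝ) : α ![x + y, z, t] = α ![x, z, t] + α ![y, z, t] :=
    α.map_vecCons_add ![z, t] x y
  have hs (c : ℝ) (x y z : Fin 6 → ℝ) : α ![c • x, y, z] = c * α ![x, y, z] :=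
    α.map_vecCons_smul ![y, z] c x
  obtain ⟨m, hm⟩ : ∃ m, α m ≠ 0 := by
    by_contra! h
    exact h0 (AlternatingMap.ext h)
  have hm' : m = ![m 0, m 1, m 2] := by ext i; fin_cases i <;> rfl
  rw [hm'] at hm
  set p := α ![m 0, m 1, m 2]
  set q := α ![I (m 0), m 1, m 2]
  have hpq : p ^ 2 + q ^ 2 ≠ 0 := by positivity
  refine ⟨(p / (p ^ 2 + q ^ 2)) • m 0 + (q / (p ^ 2 + q ^ 2)) • I (m 0), m 1, m 2, ?_, ?_⟩
  · rw [ha, hs, hs]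
    change _ * p + _ * q = 1
    field_simp
  · rw [map_add, map_smul, map_smul, hI, ← neg_one_smul ℝ, ha, hs, hs, hs]
    field_simp
    ring

theorem exists_compLinearMap_eq_alphaII {α : AlternatingMap ℝ (Fin 6 → ℝ) ℝ (Fin 3)} (h0 : α ≠ 0)
    {I : (Fin 6 → ℝ) →ₗ[ℝ] (Fin 6 → ℝ)} (hI : ∀ v, I (I v) = -v)
    (hc : ∀ u v w, α ![u, I v, w] = α ![I u, v, w]) :
    ∃ g : (Fin 6 → ℝ) →ₗ[ℝ] (Fin 6 → ℝ), α.compLinearMap g = alphaII := by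
  obtain ⟨u, v, w, h1, h2⟩ := exists_apply_eq_one_of_complex h0 hI
  have hc' := map_last_of_map_middle hc
  have hn (x y z : Fin 6 → ℝ) : α ![-x, y, z] = -α ![x, y, z] := by
    rw [← neg_one_smul ℝ x, ← neg_one_smul ℝ (α ![x, y, z])]
    exact α.map_vecCons_smul ![y, z] (-1 : ℝ) x
  have hz (x y : Fin 6 → ℝ) : α ![I x, x, y] = 0 := by
    have := α.map_swap_zero_one (I x) x y
    rw [hc] at this
    linarith
  let b : Fin 6 → Fin 6 → ℝ := ![u, I u, v, I v, w, I w]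
  refine ⟨(Pi.basisFun ℝ (Fin 6)).constr ℝ b, ?_⟩
  have hb (i : Fin 6) : (Pi.basisFun ℝ (Fin 6)).constr ℝ b (Pi.single i 1) = b i := by
    rw [← Pi.basisFun_apply, Module.Basis.constr_basis]
  refine (Pi.basisFun ℝ (Fin 6)).ext_alternating_of_strictMono fun s hs => ?_
  have key (i j k : Fin 6) (hij : i < j) (hjk : j < k) :
      α ![b i, b j, b k] = component alphaII i j k := by
    fin_cases i <;> fin_cases j <;> try exact absurd hij (by decide)
    all_goals fin_cases k <;> first
      | exact absurd hjk (by decide)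
      | simp [b, component, alphaII_apply, dx3_apply, hc, hc', hI, hn, hz, h1, h2,
          α.map_zero_one_self, α.map_one_two_self]
  have := key (s 0) (s 1) (s 2) (hs (by decide)) (hs (by decide))
  have h3 (f : Fin 3 → Fin 6 → ℝ) : f = ![f 0, f 1, f 2] := by ext i; fin_cases i <;> rfl
  rw [AlternatingMap.compLinearMap_apply, h3 fun i => Pi.basisFun ℝ (Fin 6) (s i), h3 fun i => _]
  simpa [hb, component] using this

/-- A linear map pulling a form back to `α_(ii)` is injective. -/
theorem injective_of_compLinearMap_eq_alphaII {α : AlternatingMap ℝ (Fin 6 → ℝ) ℝ (Fin 3)}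
    {g : (Fin 6 → ℝ) →ₗ[ℝ] (Fin 6 → ℝ)} (hg : α.compLinearMap g = alphaII) :
    Function.Injective g := by
  rw [injective_iff_map_eq_zero]
  intro x hx
  have h (j k : Fin 6) : alphaII ![x, Pi.single j 1, Pi.single k 1] = 0 := by
    rw [← hg, AlternatingMap.compLinearMap_apply]
    exact α.map_coord_zero 0 hx
  have h24 := h 2 4
  have h25 := h 2 5
  have h02 := h 0 2
  have h03 := h 0 3
  have h04 := h 0 4
  have h05 := h 0 5
  simp [alphaII_apply, dx3_apply] at h24 h25 h02 h03 h04 h05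
  ext i
  fin_cases i <;> simp [*]

/-- For a non-degenerate 3-form α on ℝ⁶ with invariant λ_α = trace(J_α ∘ J_α),
where J_α is determined by (ι_v α) ∧ α = ι_{J_α v} dvol, the stated sign condition
on λ_α holds iff α lies in the GL₆(ℝ)-orbit of the corresponding normal form. -/
theorem linear_type_criterion (α : AlternatingMap ℝ (Fin 6 → ℝ) ℝ (Fin 3))
    (hα : Function.Injective (fun v : Fin 6 → ℝ => α.curryLeft v))
    (J : (Fin 6 → ℝ) →ₗ[ℝ] (Fin 6 → ℝ))
    (hJ : ∀ v : Fin 6 → ℝ, wedge (α.curryLeft v) α = dvol.curryLeft (J v)) :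
    (LinearMap.trace ℝ (Fin 6 → ℝ) (J ∘ₗ J) < 0) ↔
      ∃ g : (Fin 6 → ℝ) ≃ₗ[ℝ] (Fin 6 → ℝ),
        α.compLinearMap (g : (Fin 6 → ℝ) →ₗ[ℝ] (Fin 6 → ℝ)) = alphaII := by
  constructor
  · intro hneg
    obtain ⟨c, hc⟩ := IsHitchin.exists_sq_eq_smul hJ
    have hc0 : c < 0 := by
      rw [hc, map_smul, LinearMap.trace_id] at hneg
      simp at hneg
      linarith
    have h0 : α ≠ 0 := by
      rintro rfl
      have := @hα (Pi.single 0 1) 0 (by simp)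
      simp at this
    have hr : (√(-c))⁻¹ * (√(-c))⁻¹ = -c⁻¹ := by
      rw [← mul_inv, Real.mul_self_sqrt (by linarith), inv_neg]
    obtain ⟨g, hg⟩ := exists_compLinearMap_eq_alphaII h0 (I := (√(-c))⁻¹ • J)
      (fun v => by
        have h : J (J v) = c • v := LinearMap.congr_fun hc v
        simp [h, smul_smul, ← mul_assoc, hr, hc0.ne])
      (fun u v w => by
        have h1 := (α.curryLeft u).map_vecCons_smul ![w] (√(-c))⁻¹ (J v)
        have h2 := α.map_vecCons_smul ![v, w] (√(-c))⁻¹ (J u)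
        exact h1.trans ((congrArg _ (IsHitchin.apply_comm hJ u v w)).trans h2.symm))
    exact ⟨LinearEquiv.ofInjectiveEndo g (injective_of_compLinearMap_eq_alphaII hg), hg⟩
  · rintro ⟨g, hg⟩
    have h := IsHitchin.compLinearMap hJ g
    rw [hg] at h
    have ht := h.trace_sq_neg_of_alphaII
    rw [LinearMap.smul_comp, LinearMap.comp_smul, smul_smul, map_smul, ← LinearEquiv.conj_comp,
      LinearMap.trace_conj', smul_eq_mul] at ht
    exact (pos_iff_neg_of_mul_neg ht).1 (mul_self_pos.2 (LinearEquiv.isUnit_det' g).ne_zero)
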